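/- arXiv:1706.01968 — 2 statements merged into one kernel-verified Lean document; each statement's English description precedes it below -/
import Mathlib

section
/- Let (S, T) have a min-stable distribution with unit exponential margins and Pickands dependence function A. Then H_{0,1}(1,1) = Cov(S, T·log T) = ∫₀¹ (A(w))^{−2}·[1 + log(1−w) + ψ(2) − log A(w)] dw − ψ(2). -/
open MeasureTheory Real Filter

theorem integrableOn_rpow_mul_one_add_abs_log_mul_exp {s b : ℝ} (hs : -(3 / 4) < s) (hb : 0 < b) :
    IntegrableOn (fun y : ℝ => y ^ s * (1 + |log y|) * exp (-(b * y))) (Set.Ioi 0) := by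
  have key : ∀ {r : ℝ}, -1 < r →
      IntegrableOn (fun y : ℝ => y ^ r * exp (-(b * y))) (Set.Ioi 0) := fun hr => by
    simpa using integrableOn_rpow_mul_exp_neg_mul_rpow hr one_pos hb
  have hdom := ((key (r := s) (by linarith)).add
    ((key (r := s - 1 / 4) (by linarith)).const_mul 4)).add (key (r := s + 1) (by linarith))
  refine Integrable.mono' hdom (by fun_prop) ?_
  filter_upwards [ae_restrict_mem measurableSet_Ioi] with y (hy : 0 < y)
  have hlog : |log y| ≤ 4 * y ^ (-(1 / 4) : ℝ) + y := by
    have hp : 0 < y ^ (1 / 4 : ℝ) := rpow_pos_of_pos hy _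
    have hp' : 0 < y ^ (-(1 / 4) : ℝ) := rpow_pos_of_pos hy _
    rcases le_total y 1 with h | h
    · have h1 := abs_log_mul_self_rpow_lt y (1 / 4) hy h (by norm_num)
      rw [abs_mul, abs_of_pos hp] at h1
      have : |log y| ≤ 4 * y ^ (-(1 / 4) : ℝ) := by
        rw [rpow_neg hy.le, ← div_eq_mul_inv, le_div_iff₀ hp]
        linarith
      linarith
    · rw [abs_of_nonneg (log_nonneg h)]
      linarith [log_le_sub_one_of_pos hy]
  have hs1 : y ^ (s - 1 / 4) = y ^ s * y ^ (-(1 / 4) : ℝ) := by rw [← rpow_add hy]; ring_nf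
  have hs2 : y ^ (s + 1) = y ^ s * y := by rw [rpow_add hy, rpow_one]
  have hpos : 0 ≤ y ^ s * exp (-(b * y)) := by positivity
  rw [norm_of_nonneg (by positivity)]
  simp only [Pi.add_apply]
  rw [hs1, hs2]
  nlinarith [mul_le_mul_of_nonneg_left hlog hpos]

theorem integrableOn_id_mul_exp_neg :
    IntegrableOn (fun y : ℝ => y * exp (-y)) (Set.Ioi 0) := by
  have := integrableOn_rpow_mul_exp_neg_mul_rpow (s := 1) (p := 1) (b := 1)
    (by norm_num) one_pos one_pos
  simpa using this

theorem integrableOn_id_mul_log_mul_exp_neg :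
    IntegrableOn (fun y : ℝ => y * log y * exp (-y)) (Set.Ioi 0) := by
  refine Integrable.mono' (integrableOn_rpow_mul_one_add_abs_log_mul_exp (s := 1) (b := 1)
    (by norm_num) one_pos) (by fun_prop) ?_
  filter_upwards [ae_restrict_mem measurableSet_Ioi] with y (hy : 0 < y)
  rw [norm_mul, norm_mul, norm_of_nonneg hy.le, norm_of_nonneg (exp_pos _).le, rpow_one, one_mul,
    norm_eq_abs]
  gcongr
  linarith

theorem integral_id_mul_exp_neg : ∫ y in Set.Ioi (0 : ℝ), y * exp (-y) = 1 := by
  have := integral_rpow_mul_exp_neg_mul_Ioi (a := 2) (r := 1) two_pos one_pos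
  norm_num at this
  simpa using this

theorem integral_id_mul_log_mul_exp_neg :
    ∫ y in Set.Ioi (0 : ℝ), y * log y * exp (-y) = deriv Gamma 2 := by
  have h1 := Complex.hasDerivAt_GammaIntegral (s := ((2 : ℝ) : ℂ)) (by simp)
  have h2 := h1.real_of_complex
  have h3 : (fun x : ℝ => (Complex.GammaIntegral x).re) =ᶠ[nhds 2] Gamma := by
    filter_upwards [lt_mem_nhds (show (0 : ℝ) < 2 by norm_num)] with x hx
    rw [← Complex.Gamma_eq_integral (by simpa using hx), Gamma]
  rw [← h3.deriv_eq, h2.deriv]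
  have h4 : ∀ t : ℝ, (t : ℂ) ^ (((2 : ℝ) : ℂ) - 1) * ((log t : ℂ) * (exp (-t) : ℂ))
      = ((t * log t * exp (-t) : ℝ) : ℂ) := fun t => by
    rw [show (((2 : ℝ) : ℂ) - 1) = 1 by norm_num, Complex.cpow_one]
    push_cast
    ring
  simp_rw [h4]
  rw [integral_complex_ofReal, Complex.ofReal_re]

theorem integral_id_mul_one_add_log_mul_exp_neg_mul {c : ℝ} (hc : 0 < c) :
    ∫ y in Set.Ioi (0 : ℝ), y * (1 + log y) * exp (-(y * c))
      = (c ^ 2)⁻¹ * (1 + deriv Gamma 2 - log c) := by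
  have h1 : ∫ y in Set.Ioi (0 : ℝ), y * (1 + log y) * exp (-(y * c))
      = ∫ y in Set.Ioi (0 : ℝ),
        (fun z => c⁻¹ * ((1 - log c) * (z * exp (-z)) + z * log z * exp (-z))) (c * y) := by
    refine setIntegral_congr_fun measurableSet_Ioi fun y (hy : 0 < y) => ?_
    simp only
    rw [log_mul hc.ne' hy.ne', mul_comm y c]
    field_simp
    ring
  rw [h1, integral_comp_mul_left_Ioi
    (fun z => c⁻¹ * ((1 - log c) * (z * exp (-z)) + z * log z * exp (-z))) _ hc, mul_zero, integral_const_mul,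
    integral_add (integrableOn_id_mul_exp_neg.const_mul _) integrableOn_id_mul_log_mul_exp_neg,
    integral_const_mul, integral_id_mul_exp_neg, integral_id_mul_log_mul_exp_neg, smul_eq_mul]
  field_simp
  ring

theorem setIntegral_comp_div_one_sub (g : ℝ → ℝ) :
    ∫ u in Set.Ioi (0 : ℝ), g u
      = ∫ w in Set.Ioo (0 : ℝ) 1, ((1 - w) ^ 2)⁻¹ * g (w / (1 - w)) := by
  have himage : (fun w : ℝ => w / (1 - w)) '' Set.Ioo 0 1 = Set.Ioi 0 := by
    ext u
    constructor
    · rintro ⟨w, ⟨h0, h1⟩, rfl⟩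
      exact div_pos h0 (by linarith)
    · intro (hu : 0 < u)
      refine ⟨u / (1 + u), ⟨by positivity, by rw [div_lt_one (by positivity)]; linarith⟩, ?_⟩
      simp only
      field_simp
      ring
  rw [← himage, integral_image_eq_integral_abs_deriv_smul (f' := fun w => ((1 - w) ^ 2)⁻¹)
    measurableSet_Ioo]
  · refine setIntegral_congr_fun measurableSet_Ioo fun w _ => ?_
    simp only [smul_eq_mul]
    rw [abs_of_nonneg (by positivity)]
  · intro w hw
    have hne : 1 - w ≠ 0 := by linarith [hw.2]
    convert! ((hasDerivAt_id w).div ((hasDerivAt_id w).const_sub 1) hne).hasDerivWithinAt using 1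
    simp only [id]
    field_simp
    ring
  · intro a ha b hb hab
    have h1 : 1 - a ≠ 0 := by linarith [ha.2]
    have h2 : 1 - b ≠ 0 := by linarith [hb.2]
    simp only at hab
    rw [div_eq_div_iff h1 h2] at hab
    linarith

open ProbabilityTheory in
theorem map_eq_expMeasure_one {Ω : Type*} [MeasurableSpace Ω] {μ : Measure Ω}
    [IsProbabilityMeasure μ] {X : Ω → ℝ} (hX : Measurable X)
    (h : ∀ x : ℝ, 0 < x → (μ {ω | x < X ω}).toReal = exp (-x)) (hpos : ∀ᵐ ω ∂μ, 0 < X ω) :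
    μ.map X = expMeasure 1 := by
  have : IsProbabilityMeasure (μ.map X) := Measure.isProbabilityMeasure_map hX.aemeasurable
  have : IsProbabilityMeasure (expMeasure 1) := isProbabilityMeasure_expMeasure one_pos
  refine Measure.eq_of_cdf _ _ ?_
  ext x
  rw [cdf_expMeasure_eq one_pos, cdf_eq_real, map_measureReal_apply hX measurableSet_Iic]
  have hzero : ∀ x ≤ 0, μ.real (X ⁻¹' Set.Iic x) = 0 := fun x hx => by
    rw [measureReal_def, measure_eq_zero_iff_ae_notMem.2, ENNReal.toReal_zero]
    filter_upwards [hpos] with ω hω (hle : X ω ≤ x)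
    linarith
  rcases le_or_gt x 0 with hx | hx
  · rw [hzero x hx]
    split_ifs with h0
    · simp [le_antisymm hx h0]
    · rfl
  · rw [if_pos hx.le, one_mul, ← h x hx, ← measureReal_def,
      ← probReal_compl_eq_one_sub (measurableSet_lt measurable_const hX)]
    congr 1
    ext ω
    simp

open ProbabilityTheory in
theorem integral_expMeasure_one (g : ℝ → ℝ) :
    ∫ x, g x ∂(expMeasure 1) = ∫ x in Set.Ioi 0, g x * exp (-x) := by
  have hm : Measurable (gammaPDF 1 1) := (measurable_gammaPDFReal 1 1).ennreal_ofReal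
  rw [expMeasure, gammaMeasure, integral_withDensity_eq_integral_toReal_smul hm
    (by simp [gammaPDF]),
    ← integral_Ici_eq_integral_Ioi, ← integral_indicator measurableSet_Ici]
  congr 1
  ext x
  by_cases hx : 0 ≤ x
  · simp [gammaPDF, gammaPDFReal, hx, (exp_pos _).le, mul_comm]
  · simp [gammaPDF, gammaPDFReal, hx]

theorem mul_exp_neg_mul_le {v y : ℝ} (hv : 0 < v) (hy : 0 < y) :
    y * exp (-(y * (v / 2)))
      ≤ 33 * v ^ (-(3 / 2) : ℝ) * (y ^ (-(1 / 2) : ℝ) * exp (-(1 / 4 * (y * v)))) := by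
  have hz : 0 < y * v := mul_pos hy hv
  have hpow : (y * v) ^ (3 / 2 : ℝ) ≤ 1 + (y * v) ^ 2 := by
    rcases le_total (y * v) 1 with h | h
    · nlinarith [rpow_le_one hz.le h (by norm_num : (0 : ℝ) ≤ 3 / 2), sq_nonneg (y * v)]
    · have := rpow_le_rpow_of_exponent_le h (by norm_num : (3 / 2 : ℝ) ≤ 2)
      rw [rpow_two] at this
      linarith
  have hexp : (y * v) ^ (3 / 2 : ℝ) ≤ 33 * exp (1 / 4 * (y * v)) := by
    nlinarith [quadratic_le_exp_of_nonneg (show 0 ≤ 1 / 4 * (y * v) by positivity)]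
  have hy' : y = y ^ (3 / 2 : ℝ) * y ^ (-(1 / 2) : ℝ) := by
    rw [← rpow_add hy]
    norm_num
  have hv' : v ^ (3 / 2 : ℝ) * v ^ (-(3 / 2) : ℝ) = 1 := by
    rw [← rpow_add hv]
    norm_num
  have hsplit : exp (1 / 4 * (y * v)) * exp (-(y * (v / 2))) = exp (-(1 / 4 * (y * v))) := by
    rw [← exp_add]
    ring_nf
  calc y * exp (-(y * (v / 2)))
      = y ^ (3 / 2 : ℝ) * y ^ (-(1 / 2) : ℝ) * (v ^ (3 / 2 : ℝ) * v ^ (-(3 / 2) : ℝ))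
          * exp (-(y * (v / 2))) := by rw [hv', ← hy', mul_one]
    _ = (y * v) ^ (3 / 2 : ℝ) * (v ^ (-(3 / 2) : ℝ) * y ^ (-(1 / 2) : ℝ)
          * exp (-(y * (v / 2)))) := by
        rw [mul_rpow hy.le hv.le]
        ring
    _ ≤ 33 * exp (1 / 4 * (y * v)) * (v ^ (-(3 / 2) : ℝ) * y ^ (-(1 / 2) : ℝ)
          * exp (-(y * (v / 2)))) := by gcongr
    _ = _ := by
        rw [← hsplit]
        ring

theorem integral_one_add_log {t : ℝ} : ∫ y in (0 : ℝ)..t, (1 + log y) = t * log t := by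
  rw [intervalIntegral.integral_add (by simp) intervalIntegral.intervalIntegrable_log',
    integral_log]
  simp

theorem integral_integral_indicator_eq_mul_log {s t : ℝ} (hs : 0 < s) (ht : 0 < t) :
    ∫ y in Set.Ioi (0 : ℝ), ∫ u in Set.Ioi (0 : ℝ),
      {p : ℝ × ℝ | p.2 * p.1 < s ∧ p.2 < t}.indicator (fun p => p.2 * (1 + log p.2)) (u, y)
      = s * (t * log t) := by
  have hinner : ∀ y : ℝ, 0 < y → ∫ u in Set.Ioi (0 : ℝ),
      {p : ℝ × ℝ | p.2 * p.1 < s ∧ p.2 < t}.indicator (fun p => p.2 * (1 + log p.2)) (u, y)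
      = (Set.Iio t).indicator (fun y => s * (1 + log y)) y := fun y hy => by
    by_cases hyt : y < t
    · have heq : ∀ u : ℝ,
          {p : ℝ × ℝ | p.2 * p.1 < s ∧ p.2 < t}.indicator (fun p => p.2 * (1 + log p.2)) (u, y)
            = (Set.Iio (s / y)).indicator (fun _ => y * (1 + log y)) u := fun u => by
        simp only [Set.indicator, Set.mem_ofPred_eq, Set.mem_Iio, hyt, and_true,
          lt_div_iff₀ hy, mul_comm u]
      simp_rw [heq]
      rw [setIntegral_indicator measurableSet_Iio, Set.Ioi_inter_Iio, setIntegral_const,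
        Set.indicator_of_mem (Set.mem_Iio.2 hyt), volume_real_Ioo_of_le (by positivity), smul_eq_mul]
      field_simp
      ring
    · simp [Set.indicator, hyt]
  rw [setIntegral_congr_fun measurableSet_Ioi hinner, setIntegral_indicator measurableSet_Iio,
    Set.Ioi_inter_Iio, integral_const_mul, ← integral_Ioc_eq_integral_Ioo,
    ← intervalIntegral.integral_of_le ht.le, integral_one_add_log]

theorem integral_mul_mul_log_eq_of_survival {Ω : Type*} [MeasurableSpace Ω] {μ : Measure Ω}
    [IsProbabilityMeasure μ] {S T : Ω → ℝ} (hS : Measurable S) (hT : Measurable T)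
    (hSpos : ∀ᵐ ω ∂μ, 0 < S ω) (hTpos : ∀ᵐ ω ∂μ, 0 < T ω) {c : ℝ → ℝ}
    (hc : ∀ u, 0 < u → (1 + u) / 2 ≤ c u)
    (h : ∀ u y, 0 < u → 0 < y → μ.real {ω | y * u < S ω ∧ y < T ω} = exp (-(y * c u))) :
    ∫ ω, S ω * (T ω * log (T ω)) ∂μ
      = ∫ u in Set.Ioi (0 : ℝ), ((c u) ^ 2)⁻¹ * (1 + deriv Gamma 2 - log (c u)) := by
  set ν : Measure ℝ := volume.restrict (Set.Ioi 0) with hν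
  set E : Set (Ω × ℝ × ℝ) := {p | p.2.2 * p.2.1 < S p.1 ∧ p.2.2 < T p.1}
  set F : Ω × ℝ × ℝ → ℝ := E.indicator (fun p => p.2.2 * (1 + log p.2.2))
  have hEm : MeasurableSet E :=
    MeasurableSet.inter (s₁ := {p : Ω × ℝ × ℝ | p.2.2 * p.2.1 < S p.1})
      (s₂ := {p : Ω × ℝ × ℝ | p.2.2 < T p.1})
      (measurableSet_lt (by fun_prop) (by fun_prop))
      (measurableSet_lt (by fun_prop) (by fun_prop))
  have hFm : StronglyMeasurable F := by
    refine Measurable.stronglyMeasurable (Measurable.indicator ?_ hEm)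
    fun_prop
  have hslice : ∀ p : ℝ × ℝ, MeasurableSet {ω | p.2 * p.1 < S ω ∧ p.2 < T ω} := fun p =>
    (measurableSet_lt (by fun_prop) hS).inter (measurableSet_lt (by fun_prop) hT)
  have hFslice : ∀ p : ℝ × ℝ, (fun ω => F (ω, p))
      = {ω | p.2 * p.1 < S ω ∧ p.2 < T ω}.indicator (fun _ => p.2 * (1 + log p.2)) := fun p => rfl
  have hpos : ∀ᵐ p ∂(ν.prod ν), 0 < p.1 ∧ 0 < p.2 := by
    rw [hν, Measure.prod_restrict]
    exact ae_restrict_mem (measurableSet_Ioi.prod measurableSet_Ioi)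
  have hdom : Integrable (fun p : ℝ × ℝ => (33 * (p.1 + 1) ^ (-(3 / 2) : ℝ))
      * (p.2 ^ (-(1 / 2) : ℝ) * (1 + |log p.2|) * exp (-(1 / 4 * p.2)))) (ν.prod ν) :=
    Integrable.mul_prod
      ((integrableOn_add_rpow_Ioi_of_lt (by norm_num) (by norm_num)).const_mul 33)
      (integrableOn_rpow_mul_one_add_abs_log_mul_exp (by norm_num) (by norm_num))
  have hFint : Integrable F (μ.prod (ν.prod ν)) := by
    rw [integrable_prod_iff' hFm.aestronglyMeasurable]
    refine ⟨Eventually.of_forall fun p => ?_, ?_⟩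
    · rw [hFslice]
      exact (integrable_const _).indicator (hslice p)
    · refine Integrable.mono' hdom
        (hFm.norm.integral_prod_left' (μ := μ)).aestronglyMeasurable ?_
      filter_upwards [hpos] with ⟨u, y⟩ ⟨hu, hy⟩
      have hnorm : ∫ ω, ‖F (ω, (u, y))‖ ∂μ = |y * (1 + log y)| * exp (-(y * c u)) := by
        rw [← h u y hu hy, mul_comm, ← smul_eq_mul, ← setIntegral_const,
          ← integral_indicator (hslice (u, y))]
        congr 1
        ext ω
        rw [show F (ω, (u, y)) = _ from congrFun (hFslice (u, y)) ω,
          norm_indicator_eq_indicator_norm]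
        rfl
      rw [hnorm, norm_of_nonneg (by positivity)]
      have hexp : exp (-(y * c u)) ≤ exp (-(y * ((u + 1) / 2))) := by
        gcongr
        linarith [hc u hu]
      have hexp' : exp (-(1 / 4 * (y * (u + 1)))) ≤ exp (-(1 / 4 * y)) := by
        gcongr
        nlinarith
      have hlog : |1 + log y| ≤ 1 + |log y| := by
        simpa using abs_add_le 1 (log y)
      calc |y * (1 + log y)| * exp (-(y * c u))
          ≤ (1 + |log y|) * (y * exp (-(y * ((u + 1) / 2)))) := by
            rw [abs_mul, abs_of_pos hy, mul_comm y, mul_assoc]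
            gcongr
        _ ≤ (1 + |log y|) * (33 * (u + 1) ^ (-(3 / 2) : ℝ)
              * (y ^ (-(1 / 2) : ℝ) * exp (-(1 / 4 * (y * (u + 1)))))) :=
            mul_le_mul_of_nonneg_left (mul_exp_neg_mul_le (add_pos hu one_pos) hy) (by positivity)
        _ ≤ (1 + |log y|) * (33 * (u + 1) ^ (-(3 / 2) : ℝ)
              * (y ^ (-(1 / 2) : ℝ) * exp (-(1 / 4 * y)))) := by gcongr
        _ = _ := by ring
  have hleft : ∫ z, F z ∂(μ.prod (ν.prod ν)) = ∫ ω, S ω * (T ω * log (T ω)) ∂μ := by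
    rw [integral_prod _ hFint]
    refine integral_congr_ae ?_
    filter_upwards [hSpos, hTpos, hFint.prod_right_ae] with ω hs ht hint
    rw [integral_prod_symm _ hint, ← integral_integral_indicator_eq_mul_log hs ht]
    rfl
  have hright : ∫ z, F z ∂(μ.prod (ν.prod ν))
      = ∫ u in Set.Ioi (0 : ℝ), ((c u) ^ 2)⁻¹ * (1 + deriv Gamma 2 - log (c u)) := by
    rw [integral_prod_symm _ hFint, integral_prod _ hFint.integral_prod_right]
    refine setIntegral_congr_fun measurableSet_Ioi fun u (hu : 0 < u) => ?_
    rw [← integral_id_mul_one_add_log_mul_exp_neg_mul (by linarith [hc u hu])]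
    refine setIntegral_congr_fun measurableSet_Ioi fun y (hy : 0 < y) => ?_
    rw [hFslice, integral_indicator (hslice (u, y)), setIntegral_const, smul_eq_mul]
    simp only
    rw [h u y hu hy, mul_comm]
  rw [← hleft, hright]

theorem ae_pos_of_survival {Ω : Type*} [MeasurableSpace Ω] {μ : Measure Ω}
    [IsProbabilityMeasure μ] {X Y : Ω → ℝ} (hX : Measurable X) (hY : Measurable Y)
    (h : ∀ x : ℝ, 0 < x → μ.real {ω | x < X ω ∧ 0 < Y ω} = exp (-x)) :
    ∀ᵐ ω ∂μ, 0 < X ω ∧ 0 < Y ω := by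
  have hle : ∀ x : ℝ, 0 < x → exp (-x) ≤ μ.real {ω | 0 < X ω ∧ 0 < Y ω} := fun x hx => by
    rw [← h x hx]
    exact measureReal_mono fun ω hω => ⟨hx.trans hω.1, hω.2⟩
  have hlim : Tendsto (fun x : ℝ => exp (-x)) (nhdsWithin 0 (Set.Ioi 0)) (nhds 1) := by
    have : Continuous fun x : ℝ => exp (-x) := by fun_prop
    simpa using (this.tendsto 0).mono_left nhdsWithin_le_nhds
  have hone : 1 ≤ μ.real {ω | 0 < X ω ∧ 0 < Y ω} :=
    le_of_tendsto hlim (by filter_upwards [self_mem_nhdsWithin] with x hx using hle x hx)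
  have hmeas : MeasurableSet {ω | 0 < X ω ∧ 0 < Y ω} :=
    (measurableSet_lt measurable_const hX).inter (measurableSet_lt measurable_const hY)
  rw [ae_iff]
  refine (prob_compl_eq_zero_iff hmeas).2 ?_
  rw [← ENNReal.toReal_eq_one_iff]
  exact le_antisymm measureReal_le_one hone

theorem minStable_cov_S_TlogT
    {Ω : Type*} [MeasurableSpace Ω] (μ : Measure Ω) [IsProbabilityMeasure μ]
    (S T : Ω → ℝ) (hS : Measurable S) (hT : Measurable T)
    (A : ℝ → ℝ)
    (hAconv : ConvexOn ℝ (Set.Icc (0:ℝ) 1) A)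
    (hAbound : ∀ w ∈ Set.Icc (0:ℝ) 1, max w (1 - w) ≤ A w ∧ A w ≤ 1)
    (hsurv : ∀ x y : ℝ, 0 ≤ x → 0 ≤ y → (x, y) ≠ (0, 0) →
      (μ {ω | x < S ω ∧ y < T ω}).toReal = Real.exp (-((x + y) * A (x / (x + y)))))
    :
    (∫ ω, S ω * (T ω * Real.log (T ω)) ∂μ)
        - (∫ ω, S ω ∂μ) * (∫ ω, T ω * Real.log (T ω) ∂μ)
      = (∫ w in (0:ℝ)..1, (A w) ^ (-2 : ℝ)
            * (1 + Real.log (1 - w) + deriv Real.Gamma 2 / Real.Gamma 2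
                - Real.log (A w)))
          - deriv Real.Gamma 2 / Real.Gamma 2 := by
  have hA0 : A 0 = 1 := by
    have := hAbound 0 (by simp)
    exact le_antisymm this.2 (by simpa using this.1)
  have hA1 : A 1 = 1 := by
    have := hAbound 1 (by simp)
    exact le_antisymm this.2 (by simpa using this.1)
  have hsurvS : ∀ x : ℝ, 0 < x → μ.real {ω | x < S ω ∧ 0 < T ω} = exp (-x) := fun x hx => by
    simpa [measureReal_def, hx.ne', hA1] using hsurv x 0 hx.le le_rfl (by simp [hx.ne'])
  have hsurvT : ∀ y : ℝ, 0 < y → μ.real {ω | 0 < S ω ∧ y < T ω} = exp (-y) := fun y hy => by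
    simpa [measureReal_def, hA0] using hsurv 0 y le_rfl hy.le (by simp [hy.ne'])
  have hpos := ae_pos_of_survival hS hT hsurvS
  have hSpos : ∀ᵐ ω ∂μ, 0 < S ω := hpos.mono fun _ h => h.1
  have hTpos : ∀ᵐ ω ∂μ, 0 < T ω := hpos.mono fun _ h => h.2
  have hlawS : μ.map S = ProbabilityTheory.expMeasure 1 := by
    refine map_eq_expMeasure_one hS (fun x hx => ?_) hSpos
    rw [← hsurvS x hx, measureReal_def]
    congr 1
    refine measure_congr ?_
    filter_upwards [hTpos] with ω hω
    exact propext ⟨fun h => ⟨h, hω⟩, fun h => h.1⟩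
  have hlawT : μ.map T = ProbabilityTheory.expMeasure 1 := by
    refine map_eq_expMeasure_one hT (fun y hy => ?_) hTpos
    rw [← hsurvT y hy, measureReal_def]
    congr 1
    refine measure_congr ?_
    filter_upwards [hSpos] with ω hω
    exact propext ⟨fun h => ⟨hω, h⟩, fun h => h.2⟩
  have hES : ∫ ω, S ω ∂μ = 1 := by
    rw [← integral_map (f := fun x => x) hS.aemeasurable (by fun_prop), hlawS,
      integral_expMeasure_one, integral_id_mul_exp_neg]
  have hET : ∫ ω, T ω * log (T ω) ∂μ = deriv Gamma 2 := by
    rw [← integral_map (f := fun x => x * log x) hT.aemeasurable (by fun_prop), hlawT,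
      integral_expMeasure_one, integral_id_mul_log_mul_exp_neg]
  have hmix := integral_mul_mul_log_eq_of_survival hS hT hSpos hTpos
    (c := fun u => (1 + u) * A (u / (1 + u)))
    (fun u hu => by
      have hmem : u / (1 + u) ∈ Set.Icc (0 : ℝ) 1 :=
        ⟨by positivity, by rw [div_le_one (by positivity)]; linarith⟩
      have hA := (hAbound _ hmem).1
      have hhalf : 1 / 2 ≤ A (u / (1 + u)) := by
        linarith [le_max_left (u / (1 + u)) (1 - u / (1 + u)),
          le_max_right (u / (1 + u)) (1 - u / (1 + u))]
      nlinarith)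
    (fun u y hu hy => by
      rw [measureReal_def, hsurv (y * u) y (by positivity) hy.le (by simp [hy.ne']),
        show y * u / (y * u + y) = u / (1 + u) by field_simp; ring]
      ring_nf)
  have hGamma : Gamma 2 = 1 := by simp
  rw [hmix, hES, hET, hGamma, div_one, one_mul, setIntegral_comp_div_one_sub,
    intervalIntegral.integral_of_le zero_le_one, integral_Ioc_eq_integral_Ioo]
  congr 1
  refine setIntegral_congr_fun measurableSet_Ioo fun w hw => ?_
  have hw1 : 0 < 1 - w := by linarith [hw.2]
  have hAw : 0 < A w :=
    (lt_max_of_lt_left hw.1).trans_le (hAbound w (Set.Ioo_subset_Icc_self hw)).1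
  have h1 : 1 + w / (1 - w) = (1 - w)⁻¹ := by
    field_simp
    ring
  have h2 : w / (1 - w) / (1 - w)⁻¹ = w := by field_simp
  simp only [h1, h2]
  rw [log_mul (inv_ne_zero hw1.ne') hAw.ne', log_inv, rpow_neg hAw.le, rpow_two]
  field_simp
  ring
end

section
/- Let (S, T) have a min-stable distribution with unit exponential margins and Pickands dependence function A. Then H_{1,1}(1,1) = Cov(S·log S, T·log T) = ∫₀¹ (A(w))^{−2}·[ψ(2)² + 2ψ(2) + ψ'(2) + 1 + (1+ψ(2))·(log w + log(1−w) − 2·log A(w)) + (log w − log A(w))·(log(1−w) − log A(w))] dw − ψ(2)². -/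
open MeasureTheory Real Filter

section LogMoments

open Asymptotics Set
open scoped Topology

lemma isBigO_atTop_log_pow_mul_exp_neg (n : ℕ) (a : ℝ) :
    (fun t : ℝ => log t ^ n * exp (-t)) =O[atTop] (· ^ (-a)) := by
  induction n generalizing a with
  | zero => simpa using (isLittleO_exp_neg_mul_rpow_atTop zero_lt_one (-a)).isBigO
  | succ n ih =>
    refine (isBigO_rpow_top_log_smul (lt_add_one a) (ih (a + 1))).congr_left fun t => ?_
    rw [smul_eq_mul]; ring

lemma isBigO_zero_log_pow_mul_exp_neg (n : ℕ) {b : ℝ} (hb : 0 < b) :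
    (fun t : ℝ => log t ^ n * exp (-t)) =O[𝓝[>] 0] (· ^ (-b)) := by
  induction n generalizing b with
  | zero =>
    refine IsBigO.of_bound 1 ?_
    filter_upwards [Ioo_mem_nhdsGT (zero_lt_one (α := ℝ))] with t ht
    have h1 : exp (-t) ≤ 1 := exp_le_one_iff.mpr (by linarith [ht.1])
    have h2 : 1 ≤ t ^ (-b) := one_le_rpow_of_pos_of_le_one_of_nonpos ht.1 ht.2.le (by linarith)
    rw [pow_zero, one_mul, one_mul, norm_of_nonneg (exp_pos _).le, norm_of_nonneg (by linarith)]
    linarith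
  | succ n ih =>
    refine (isBigO_rpow_zero_log_smul (half_lt_self hb) (ih (half_pos hb))).congr_left
      fun t => ?_
    rw [smul_eq_mul]; ring

lemma locallyIntegrableOn_log_pow_mul_exp_neg (n : ℕ) :
    LocallyIntegrableOn (fun t : ℝ => ((log t ^ n * exp (-t) : ℝ) : ℂ)) (Ioi 0) := by
  refine ContinuousOn.locallyIntegrableOn ?_ measurableSet_Ioi
  refine Complex.continuous_ofReal.comp_continuousOn ?_
  refine ((continuousOn_log.mono fun t ht => ?_).pow n).mul (by fun_prop)
  exact (mem_Ioi.mp ht).ne'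

/-- The `n`-th logarithmic moment of the Gamma integral, which is the `n`-th derivative of `Γ`. -/
noncomputable def gammaLogMoment (n : ℕ) (x : ℝ) : ℝ :=
  ∫ t in Ioi (0 : ℝ), t ^ (x - 1) * (log t ^ n * exp (-t))

lemma cpow_smul_ofReal_eq {t : ℝ} (ht : 0 < t) (x y : ℝ) :
    (t : ℂ) ^ ((x : ℂ) - 1) • (y : ℂ) = ((t ^ (x - 1) * y : ℝ) : ℂ) := by
  rw [smul_eq_mul, Complex.ofReal_mul, Complex.ofReal_cpow ht.le]
  push_cast; rfl

lemma mellin_log_pow_mul_exp_neg (n : ℕ) (x : ℝ) :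
    mellin (fun t : ℝ => ((log t ^ n * exp (-t) : ℝ) : ℂ)) x = gammaLogMoment n x := by
  rw [mellin, gammaLogMoment, ← integral_complex_ofReal]
  exact setIntegral_congr_fun measurableSet_Ioi fun t ht => cpow_smul_ofReal_eq ht x _

lemma integrableOn_rpow_mul_log_pow_mul_exp_neg (n : ℕ) {x : ℝ} (hx : 0 < x) :
    IntegrableOn (fun t : ℝ => t ^ (x - 1) * (log t ^ n * exp (-t))) (Ioi 0) := by
  have h := mellinConvergent_of_isBigO_rpow (s := (x : ℂ))
    (locallyIntegrableOn_log_pow_mul_exp_neg n)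
    (Complex.isBigO_ofReal_left.mpr (isBigO_atTop_log_pow_mul_exp_neg n (x + 1))) (by simp)
    (Complex.isBigO_ofReal_left.mpr (isBigO_zero_log_pow_mul_exp_neg n (half_pos hx)))
    (by simpa using hx)
  exact (IntegrableOn.congr_fun h (g := fun t : ℝ =>
    ((t ^ (x - 1) * (log t ^ n * exp (-t)) : ℝ) : ℂ))
    (fun t ht => cpow_smul_ofReal_eq ht x _) measurableSet_Ioi).re

lemma hasDerivAt_gammaLogMoment (n : ℕ) {x : ℝ} (hx : 0 < x) :
    HasDerivAt (gammaLogMoment n) (gammaLogMoment (n + 1) x) x := by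
  have h := (mellin_hasDerivAt_of_isBigO_rpow (s := (x : ℂ))
    (locallyIntegrableOn_log_pow_mul_exp_neg n)
    (Complex.isBigO_ofReal_left.mpr (isBigO_atTop_log_pow_mul_exp_neg n (x + 1))) (by simp)
    (Complex.isBigO_ofReal_left.mpr (isBigO_zero_log_pow_mul_exp_neg n (half_pos hx)))
    (by simpa using hx)).2
  have e : (fun t : ℝ => log t • ((log t ^ n * exp (-t) : ℝ) : ℂ))
      = fun t : ℝ => ((log t ^ (n + 1) * exp (-t) : ℝ) : ℂ) := by
    ext t
    rw [Complex.real_smul, ← Complex.ofReal_mul, pow_succ']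
    ring_nf
  rw [e] at h
  have h' := h.real_of_complex
  simpa only [mellin_log_pow_mul_exp_neg, Complex.ofReal_re] using h'

lemma gammaLogMoment_zero {x : ℝ} (hx : 0 < x) : gammaLogMoment 0 x = Gamma x := by
  rw [Gamma_eq_integral hx, gammaLogMoment]
  simp [mul_comm]

lemma deriv_Gamma_eq_gammaLogMoment {x : ℝ} (hx : 0 < x) :
    deriv Gamma x = gammaLogMoment 1 x := by
  refine ((hasDerivAt_gammaLogMoment 0 hx).congr_of_eventuallyEq ?_).deriv
  filter_upwards [lt_mem_nhds hx] with y hy using (gammaLogMoment_zero hy).symm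

lemma deriv_digamma_eq {x : ℝ} (hx : 0 < x) :
    deriv (fun z => deriv Gamma z / Gamma z) x
      = (gammaLogMoment 2 x * Gamma x - gammaLogMoment 1 x ^ 2) / Gamma x ^ 2 := by
  have h := (hasDerivAt_gammaLogMoment 1 hx).div (hasDerivAt_gammaLogMoment 0 hx)
    (by rw [gammaLogMoment_zero hx]; exact (Gamma_pos_of_pos hx).ne')
  rw [gammaLogMoment_zero hx] at h
  rw [(h.congr_of_eventuallyEq ?_).deriv]
  · ring
  · filter_upwards [lt_mem_nhds hx] with y hy
    rw [deriv_Gamma_eq_gammaLogMoment hy, Pi.div_apply, gammaLogMoment_zero hy]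

lemma integrableOn_one_add_log_mul_exp_neg_half :
    IntegrableOn (fun t : ℝ => (1 + log t) * exp (-(t / 2))) (Ioi 0) := by
  have h : IntegrableOn (fun t : ℝ => (1 + log 2 + log t) * exp (-t)) (Ioi 0) := by
    have h0 := (integrableOn_rpow_mul_log_pow_mul_exp_neg 0 one_pos).const_mul (1 + log 2)
    have h1 := integrableOn_rpow_mul_log_pow_mul_exp_neg 1 one_pos
    refine (h0.add h1).congr (.of_forall fun t => ?_)
    simp only [Pi.add_apply, sub_self, rpow_zero, pow_zero, pow_one]; ring
  have h' := (integrableOn_Ioi_comp_mul_left_iff _ 0 (one_half_pos (α := ℝ))).mpr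
    (by rwa [mul_zero])
  refine h'.congr_fun (fun t ht => ?_) measurableSet_Ioi
  have ht' : t ≠ 0 := (mem_Ioi.mp ht).ne'
  simp only
  rw [log_mul (by norm_num) ht', one_div, log_inv]
  ring_nf

lemma integral_quadratic_log_mul_exp_neg (α β : ℝ) :
    ∫ u in Ioi (0 : ℝ), u * ((1 + log u + α) * (1 + log u + β)) * exp (-u)
      = (1 + α) * (1 + β) + (2 + α + β) * gammaLogMoment 1 2 + gammaLogMoment 2 2 := by
  have h (n : ℕ) := integrableOn_rpow_mul_log_pow_mul_exp_neg n two_pos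
  have h0 : gammaLogMoment 0 2 = 1 := by rw [gammaLogMoment_zero two_pos, Gamma_two]
  have e : (1 + α) * (1 + β) + (2 + α + β) * gammaLogMoment 1 2 + gammaLogMoment 2 2
      = (1 + α) * (1 + β) * gammaLogMoment 0 2 + (2 + α + β) * gammaLogMoment 1 2
        + gammaLogMoment 2 2 := by rw [h0, mul_one]
  rw [e, gammaLogMoment, gammaLogMoment, gammaLogMoment,
    ← integral_const_mul, ← integral_const_mul,
    ← integral_add ((h 0).const_mul _) ((h 1).const_mul _),
    ← integral_add ?_ (h 2)]
  swap
  · exact ((h 0).const_mul _).add ((h 1).const_mul _)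
  refine integral_congr_ae (.of_forall fun t => ?_)
  have : (2 : ℝ) - 1 = 1 := by norm_num
  simp only [this, rpow_one]
  ring

lemma integral_mul_one_add_log_mul_exp_neg_mul {a w v : ℝ} (ha : 0 < a) (hw : 0 < w)
    (hv : 0 < v) :
    ∫ r in Ioi (0 : ℝ), r * ((1 + log (r * w)) * (1 + log (r * v)) * exp (-(r * a)))
      = a ^ (-2 : ℝ) * ((1 + (log w - log a)) * (1 + (log v - log a))
          + (2 + (log w - log a) + (log v - log a)) * gammaLogMoment 1 2
          + gammaLogMoment 2 2) := by
  rw [← integral_quadratic_log_mul_exp_neg]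
  have h := integral_comp_mul_left_Ioi (fun u : ℝ => u * ((1 + log u + (log w - log a))
    * (1 + log u + (log v - log a))) * exp (-u)) 0 ha
  rw [mul_zero, smul_eq_mul] at h
  rw [rpow_neg ha.le, rpow_two, sq, mul_inv, mul_assoc, ← h, ← integral_const_mul]
  refine setIntegral_congr_fun measurableSet_Ioi fun r hr => ?_
  have hr' : r ≠ 0 := (mem_Ioi.mp hr).ne'
  rw [log_mul hr' hw.ne', log_mul hr' hv.ne', log_mul ha.ne' hr']
  field_simp
  ring_nf

end LogMoments

section SimplexCoordinates

open Set

/-- The map `(r, w) ↦ (r w, r (1 - w))` parametrizes the open quadrant. -/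
lemma image_mul_simplex :
    (fun p : ℝ × ℝ => (p.1 * p.2, p.1 * (1 - p.2))) '' (Ioi 0 ×ˢ Ioo 0 1) = Ioi 0 ×ˢ Ioi 0 := by
  ext ⟨x, y⟩
  simp only [mem_image, mem_prod, mem_Ioi, mem_Ioo, Prod.mk.injEq, Prod.exists]
  constructor
  · rintro ⟨r, w, ⟨hr, hw0, hw1⟩, rfl, rfl⟩
    exact ⟨mul_pos hr hw0, mul_pos hr (by linarith)⟩
  · rintro ⟨hx, hy⟩
    have hxy : 0 < x + y := by positivity
    refine ⟨x + y, x / (x + y), ⟨hxy, by positivity, ?_⟩, ?_, ?_⟩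
    · rw [div_lt_one hxy]; linarith
    · field_simp
    · field_simp; ring

lemma injOn_mul_simplex :
    InjOn (fun p : ℝ × ℝ => (p.1 * p.2, p.1 * (1 - p.2))) (Ioi 0 ×ˢ Ioo 0 1) := by
  rintro ⟨r, w⟩ ⟨hr, -⟩ ⟨r', w'⟩ - h
  simp only [Prod.mk.injEq, mem_Ioi] at h hr ⊢
  obtain rfl : r = r' := by linarith [h.1, h.2]
  exact ⟨rfl, mul_left_cancel₀ hr.ne' h.1⟩

lemma exists_hasFDerivAt_mul_simplex (p : ℝ × ℝ) :
    ∃ f' : ℝ × ℝ →L[ℝ] ℝ × ℝ,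
      HasFDerivAt (fun p : ℝ × ℝ => (p.1 * p.2, p.1 * (1 - p.2))) f' p ∧ f'.det = -p.1 := by
  refine ⟨(Matrix.toLin (.finTwoProd ℝ) (.finTwoProd ℝ)
    !![p.2, p.1; 1 - p.2, -p.1]).toContinuousLinearMap, ?_, ?_⟩
  · rw [Matrix.toLin_finTwoProd_toContinuousLinearMap]
    convert! HasFDerivAt.prodMk (𝕜 := ℝ)
      ((hasFDerivAt_fst (𝕜 := ℝ) (p := p)).mul hasFDerivAt_snd)
      ((hasFDerivAt_fst (𝕜 := ℝ) (p := p)).mul (hasFDerivAt_snd.const_sub 1)) using 2 <;>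
    simp [add_comm, neg_smul p.1 (ContinuousLinearMap.snd ℝ ℝ ℝ)]
  · simp only [LinearMap.det_toContinuousLinearMap, LinearMap.det_toLin, Matrix.det_fin_two_of]
    ring

lemma integral_quadrant_eq_integral_simplex {g : ℝ × ℝ → ℝ}
    (hg : IntegrableOn g (Ioi 0 ×ˢ Ioi 0)) :
    ∫ p in Ioi 0 ×ˢ Ioi 0, g p
      = ∫ w in Ioo (0 : ℝ) 1, ∫ r in Ioi (0 : ℝ), r * g (r * w, r * (1 - w)) := by
  choose f' hf' hdet using exists_hasFDerivAt_mul_simplex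
  have hs : MeasurableSet (Ioi (0 : ℝ) ×ˢ Ioo (0 : ℝ) 1) := measurableSet_Ioi.prod measurableSet_Ioo
  have hfw (p) (_ : p ∈ Ioi (0 : ℝ) ×ˢ Ioo (0 : ℝ) 1) :=
    (hf' p).hasFDerivWithinAt (s := Ioi 0 ×ˢ Ioo 0 1)
  have e : EqOn (fun p : ℝ × ℝ => |(f' p).det| • g (p.1 * p.2, p.1 * (1 - p.2)))
      (fun p => p.1 * g (p.1 * p.2, p.1 * (1 - p.2))) (Ioi 0 ×ˢ Ioo 0 1) := fun p hp => by
    simp only [hdet, abs_neg, abs_of_pos (mem_Ioi.mp hp.1), smul_eq_mul]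
  rw [← image_mul_simplex] at hg ⊢
  rw [integrableOn_image_iff_integrableOn_abs_det_fderiv_smul volume hs hfw injOn_mul_simplex,
    integrableOn_congr_fun e hs] at hg
  rw [integral_image_eq_integral_abs_det_fderiv_smul volume hs hfw injOn_mul_simplex,
    setIntegral_congr_fun hs e]
  rw [IntegrableOn, Measure.volume_eq_prod, ← Measure.prod_restrict] at hg
  rw [Measure.volume_eq_prod, ← Measure.prod_restrict, integral_prod_symm _ hg]

end SimplexCoordinates

section Survival

open Set

lemma integral_Ioi_indicator_one_add_log {s : ℝ} (hs : 0 < s) :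
    ∫ x in Ioi (0 : ℝ), (Iio s).indicator (fun x => 1 + log x) x = s * log s := by
  rw [setIntegral_indicator measurableSet_Iio, Ioi_inter_Iio, ← integral_Ioc_eq_integral_Ioo,
    ← intervalIntegral.integral_of_le hs.le,
    intervalIntegral.integral_add (by simp) intervalIntegral.intervalIntegrable_log',
    integral_log]
  simp

variable {Ω : Type*} [MeasurableSpace Ω] {μ : Measure Ω} [IsProbabilityMeasure μ]

lemma map_eq_expMeasure {S : Ω → ℝ} (hS : Measurable S)
    (h : ∀ x, 0 ≤ x → μ.real {ω | x < S ω} = exp (-x)) :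
    μ.map S = ProbabilityTheory.expMeasure 1 := by
  have := ProbabilityTheory.isProbabilityMeasure_expMeasure one_pos
  have := Measure.isProbabilityMeasure_map (μ := μ) hS.aemeasurable
  have key (x : ℝ) : (μ.map S).real (Iic x) = 1 - μ.real {ω | x < S ω} := by
    rw [map_measureReal_apply hS measurableSet_Iic,
      ← probReal_compl_eq_one_sub (measurableSet_lt measurable_const hS)]
    congr 1; ext ω; simp
  refine Measure.eq_of_cdf _ _ ?_
  ext x
  rw [ProbabilityTheory.cdf_expMeasure_eq one_pos, ProbabilityTheory.cdf_eq_real]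
  split_ifs with hx
  · rw [key, h x hx, one_mul]
  · refine le_antisymm ?_ measureReal_nonneg
    calc (μ.map S).real (Iic x) ≤ (μ.map S).real (Iic 0) :=
          measureReal_mono (Iic_subset_Iic.mpr (not_le.mp hx).le)
      _ = 0 := by rw [key, h 0 le_rfl]; simp

lemma integral_mul_log_eq_gammaLogMoment {S : Ω → ℝ} (hS : Measurable S)
    (h : ∀ x, 0 ≤ x → μ.real {ω | x < S ω} = exp (-x)) :
    ∫ ω, S ω * log (S ω) ∂μ = gammaLogMoment 1 2 := by
  have hm : Measurable fun t : ℝ => t * log t := measurable_id.mul measurable_log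
  rw [← integral_map (f := fun t : ℝ => t * log t) hS.aemeasurable hm.aestronglyMeasurable,
    map_eq_expMeasure hS h, ProbabilityTheory.expMeasure, ProbabilityTheory.gammaMeasure,
    integral_withDensity_eq_integral_toReal_smul
      (show Measurable (ProbabilityTheory.gammaPDF 1 1) from
        (ProbabilityTheory.measurable_gammaPDFReal 1 1).ennreal_ofReal)
      (.of_forall fun _ => ENNReal.ofReal_lt_top), gammaLogMoment,
    ← integral_indicator measurableSet_Ioi]
  refine integral_congr_ae (.of_forall fun t => ?_)
  simp only [ProbabilityTheory.gammaPDF, ProbabilityTheory.gammaPDFReal, indicator, mem_Ioi]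
  rcases lt_trichotomy t 0 with ht | rfl | ht
  · simp [ht.not_ge, ht.not_gt]
  · simp
  · have : (2 : ℝ) - 1 = 1 := by norm_num
    rw [if_pos ht.le, if_pos ht, ENNReal.toReal_ofReal (by simp; positivity)]
    simp [this]; ring

lemma integral_mul_log_mul_mul_log_eq {S T : Ω → ℝ} (hS : Measurable S) (hT : Measurable T)
    (hS0 : ∀ᵐ ω ∂μ, 0 < S ω) (hT0 : ∀ᵐ ω ∂μ, 0 < T ω)
    (hbd : ∀ x y, 0 < x → 0 < y →
      μ.real {ω | x < S ω ∧ y < T ω} ≤ exp (-(x / 2)) * exp (-(y / 2))) :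
    IntegrableOn (fun p : ℝ × ℝ => (1 + log p.1) * (1 + log p.2)
        * μ.real {ω | p.1 < S ω ∧ p.2 < T ω}) (Ioi 0 ×ˢ Ioi 0) ∧
      ∫ ω, (S ω * log (S ω)) * (T ω * log (T ω)) ∂μ
        = ∫ p in Ioi 0 ×ˢ Ioi 0, (1 + log p.1) * (1 + log p.2)
            * μ.real {ω | p.1 < S ω ∧ p.2 < T ω} := by
  set ν : Measure (ℝ × ℝ) := (volume.restrict (Ioi 0)).prod (volume.restrict (Ioi 0)) with hν
  have hνr : (volume : Measure (ℝ × ℝ)).restrict (Ioi 0 ×ˢ Ioi 0) = ν := by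
    rw [hν, Measure.prod_restrict, ← Measure.volume_eq_prod]
  set E : Set (Ω × ℝ × ℝ) := {q | q.2.1 < S q.1 ∧ q.2.2 < T q.1} with hE
  have hEm : MeasurableSet E :=
    (measurableSet_lt measurable_snd.fst (hS.comp measurable_fst)).inter
      (measurableSet_lt measurable_snd.snd (hT.comp measurable_fst))
  have hEs (p : ℝ × ℝ) : MeasurableSet {ω | p.1 < S ω ∧ p.2 < T ω} :=
    (measurableSet_lt measurable_const hS).inter (measurableSet_lt measurable_const hT)
  have hkm : Measurable fun p : ℝ × ℝ => (1 + log p.1) * (1 + log p.2) := by fun_prop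
  have hmm : Measurable fun p : ℝ × ℝ => μ.real {ω | p.1 < S ω ∧ p.2 < T ω} :=
    (measurable_measure_prodMk_right hEm).ennreal_toReal
  set F : Ω × ℝ × ℝ → ℝ := E.indicator fun q => (1 + log q.2.1) * (1 + log q.2.2) with hF
  have hFm : Measurable F := (hkm.comp measurable_snd).indicator hEm
  have hFi (p : ℝ × ℝ) : (fun ω => F (ω, p)) = {ω | p.1 < S ω ∧ p.2 < T ω}.indicator
      fun _ => (1 + log p.1) * (1 + log p.2) := rfl
  have hG : Integrable (fun p : ℝ × ℝ => (1 + log p.1) * (1 + log p.2)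
        * μ.real {ω | p.1 < S ω ∧ p.2 < T ω}) ν := by
    refine (integrableOn_one_add_log_mul_exp_neg_half.mul_prod
      integrableOn_one_add_log_mul_exp_neg_half).mono (hkm.mul hmm).aestronglyMeasurable ?_
    rw [← hν, ← hνr]
    refine (ae_restrict_iff' (measurableSet_Ioi.prod measurableSet_Ioi)).mpr
      (.of_forall fun p hp => ?_)
    rw [mul_mul_mul_comm, norm_mul, norm_mul (_ * _), norm_of_nonneg measureReal_nonneg,
      norm_of_nonneg (by positivity : 0 ≤ exp (-(p.1 / 2)) * exp (-(p.2 / 2)))]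
    gcongr
    exact hbd p.1 p.2 hp.1 hp.2
  have hFint : Integrable F (μ.prod ν) := by
    refine (integrable_prod_iff' hFm.aestronglyMeasurable).mpr ⟨.of_forall fun p => ?_, ?_⟩
    · rw [hFi]
      exact (integrable_const _).indicator (hEs p)
    · refine hG.norm.congr (.of_forall fun p => ?_)
      have : (fun ω => ‖F (ω, p)‖) = {ω | p.1 < S ω ∧ p.2 < T ω}.indicator
          fun _ => ‖(1 + log p.1) * (1 + log p.2)‖ := by
        ext ω; rw [← norm_indicator_eq_indicator_norm, ← hFi]
      simp only
      rw [this, integral_indicator_const _ (hEs p), smul_eq_mul, norm_mul,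
        norm_of_nonneg measureReal_nonneg, mul_comm]
  rw [IntegrableOn, hνr]
  refine ⟨hG, ?_⟩
  have h1 := integral_integral_swap (f := fun ω p => F (ω, p)) hFint
  have h2 : ∫ p, ∫ ω, F (ω, p) ∂μ ∂ν = ∫ p, (1 + log p.1) * (1 + log p.2)
            * μ.real {ω | p.1 < S ω ∧ p.2 < T ω} ∂ν := by
    refine integral_congr_ae (.of_forall fun p => ?_)
    simp only
    rw [hFi, integral_indicator_const _ (hEs p), smul_eq_mul, mul_comm]
  rw [← h2, ← h1]
  refine integral_congr_ae ?_
  filter_upwards [hS0, hT0] with ω hs ht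
  rw [← integral_Ioi_indicator_one_add_log hs, ← integral_Ioi_indicator_one_add_log ht,
    ← integral_prod_mul]
  refine integral_congr_ae (.of_forall fun p => ?_)
  simp only [hF, hE, indicator, mem_Iio, mem_ofPred_eq]
  split_ifs <;> simp_all

end Survival

theorem minStable_cov_SlogS_TlogT
    {Ω : Type*} [MeasurableSpace Ω] (μ : Measure Ω) [IsProbabilityMeasure μ]
    (S T : Ω → ℝ) (hS : Measurable S) (hT : Measurable T)
    (A : ℝ → ℝ)
    (hAconv : ConvexOn ℝ (Set.Icc (0:ℝ) 1) A)
    (hAbound : ∀ w ∈ Set.Icc (0:ℝ) 1, max w (1 - w) ≤ A w ∧ A w ≤ 1)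
    (hsurv : ∀ x y : ℝ, 0 ≤ x → 0 ≤ y → (x, y) ≠ (0, 0) →
      (μ {ω | x < S ω ∧ y < T ω}).toReal = Real.exp (-((x + y) * A (x / (x + y)))))
    :
    (∫ ω, (S ω * Real.log (S ω)) * (T ω * Real.log (T ω)) ∂μ)
        - (∫ ω, S ω * Real.log (S ω) ∂μ) * (∫ ω, T ω * Real.log (T ω) ∂μ)
      = (∫ w in (0:ℝ)..1, (A w) ^ (-2 : ℝ)
            * ((deriv Real.Gamma 2 / Real.Gamma 2) ^ 2
                + 2 * (deriv Real.Gamma 2 / Real.Gamma 2)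
                + deriv (fun z => deriv Real.Gamma z / Real.Gamma z) 2
                + 1
                + (1 + deriv Real.Gamma 2 / Real.Gamma 2)
                    * (Real.log w + Real.log (1 - w) - 2 * Real.log (A w))
                + (Real.log w - Real.log (A w))
                    * (Real.log (1 - w) - Real.log (A w))))
          - (deriv Real.Gamma 2 / Real.Gamma 2) ^ 2 := by
  have hA0 : A 0 = 1 := by
    have := hAbound 0 (by simp)
    exact le_antisymm this.2 (le_trans (by simp) this.1)
  have hA1 : A 1 = 1 := by
    have := hAbound 1 (by simp)
    exact le_antisymm this.2 (le_trans (by simp) this.1)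
  have hsurv' (x y : ℝ) (hx : 0 ≤ x) (hy : 0 ≤ y) :
      μ.real {ω | x < S ω ∧ y < T ω} = exp (-((x + y) * A (x / (x + y)))) := by
    rcases eq_or_ne (x, y) (0, 0) with h | h
    · simp only [Prod.mk.injEq] at h
      obtain ⟨rfl, rfl⟩ := h
      have hlim : Tendsto (fun y : ℝ => exp (-y)) (nhdsWithin 0 (Set.Ioi 0)) (nhds 1) := by
        have : ContinuousAt (fun y : ℝ => exp (-y)) 0 := by fun_prop
        simpa [ContinuousAt] using this.tendsto.mono_left nhdsWithin_le_nhds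
      rw [add_zero, zero_mul, neg_zero, exp_zero]
      refine le_antisymm measureReal_le_one (le_of_tendsto hlim ?_)
      filter_upwards [self_mem_nhdsWithin] with y hy
      have hy' : 0 < y := hy
      have h := hsurv 0 y le_rfl hy'.le (by simp [hy'.ne'])
      rw [zero_add, zero_div, hA0, mul_one] at h
      rw [← h]
      exact measureReal_mono fun ω hω => ⟨hω.1, hy'.trans hω.2⟩
    · exact hsurv x y hx hy h
  have hpos : ∀ᵐ ω ∂μ, 0 < S ω ∧ 0 < T ω := by
    have hm : MeasurableSet {ω | 0 < S ω ∧ 0 < T ω} :=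
      (measurableSet_lt measurable_const hS).inter (measurableSet_lt measurable_const hT)
    have h1 : μ.real {ω | 0 < S ω ∧ 0 < T ω} = 1 := by simp [hsurv' 0 0 le_rfl le_rfl]
    rw [ae_iff, ← Set.compl_ofPred, ← measureReal_eq_zero_iff, probReal_compl_eq_one_sub hm, h1,
      sub_self]
  have hmS (x : ℝ) (hx : 0 ≤ x) : μ.real {ω | x < S ω} = exp (-x) := by
    have h1 : x * A (x / x) = x := by
      rcases hx.eq_or_lt with rfl | hx
      · simp
      · rw [div_self hx.ne', hA1, mul_one]
    have h2 := hsurv' x 0 hx le_rfl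
    rw [add_zero, h1] at h2
    rw [← h2]
    refine measureReal_congr ?_
    filter_upwards [hpos] with ω hω
    exact propext ⟨fun h => ⟨h, hω.2⟩, fun h => h.1⟩
  have hmT (x : ℝ) (hx : 0 ≤ x) : μ.real {ω | x < T ω} = exp (-x) := by
    have h2 := hsurv' 0 x le_rfl hx
    rw [zero_add, zero_div, hA0, mul_one] at h2
    rw [← h2]
    refine measureReal_congr ?_
    filter_upwards [hpos] with ω hω
    exact propext ⟨fun h => ⟨hω.1, h⟩, fun h => h.2⟩
  have hAhalf (w : ℝ) (hw : w ∈ Set.Icc (0 : ℝ) 1) : 1 / 2 ≤ A w := by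
    have := (hAbound w hw).1
    rcases le_total w (1 / 2) with h | h
    · linarith [le_max_right w (1 - w)]
    · linarith [le_max_left w (1 - w)]
  obtain ⟨hint, heq⟩ := integral_mul_log_mul_mul_log_eq hS hT (hpos.mono fun _ h => h.1)
    (hpos.mono fun _ h => h.2) fun x y hx hy => by
      rw [hsurv' x y hx.le hy.le, ← exp_add]
      have := hAhalf (x / (x + y))
        ⟨by positivity, div_le_one_of_le₀ (by linarith) (by positivity)⟩
      exact exp_le_exp.mpr (by nlinarith)
  rw [integral_mul_log_eq_gammaLogMoment hS hmS, integral_mul_log_eq_gammaLogMoment hT hmT, heq,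
    integral_quadrant_eq_integral_simplex hint, intervalIntegral.integral_of_le zero_le_one,
    integral_Ioc_eq_integral_Ioo, deriv_digamma_eq two_pos, deriv_Gamma_eq_gammaLogMoment two_pos,
    Gamma_two]
  congr 1
  · refine setIntegral_congr_fun measurableSet_Ioo fun w hw => ?_
    have hApos : 0 < A w := by linarith [hAhalf w ⟨hw.1.le, hw.2.le⟩]
    have hw1 : 0 < 1 - w := sub_pos.mpr hw.2
    calc _ = ∫ r in Set.Ioi (0 : ℝ),
          r * ((1 + log (r * w)) * (1 + log (r * (1 - w))) * exp (-(r * A w))) := by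
          refine setIntegral_congr_fun measurableSet_Ioi fun r hr => ?_
          have hr' : 0 < r := hr
          have hsum : r * w + r * (1 - w) = r := by ring
          simp only
          rw [hsurv' _ _ (mul_pos hr' hw.1).le (mul_pos hr' hw1).le, hsum,
            mul_div_cancel_left₀ _ hr'.ne']
      _ = _ := by
          rw [integral_mul_one_add_log_mul_exp_neg_mul hApos hw.1 hw1]
          ring
  · ring
end
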